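/- (Proposition 1, part 1: stage-wise Q-value consistency.) For an N-stage structure S_1 ⊆ S_2 ⊆ ⋯ ⊆ S_N = S, define the stage-wise optimal Q-functions backwards: Q*_N = Q* and V*_N(s) = ⨆_{a} Q*_N(s,a); and for i < N, for s ∈ S_i and action sequence a with trajectory s_0 = s, s_{t+1} = f(s_t, a_t), let T = inf{ t : s_t ∉ S_i }, set G_i(s,a) = ∑_{t < T} γ^t R(s_{t+1}, a_t) + γ^T V*_{i+1}(s_T) when T < ∞ and G_i(s,a) = G(s,a) when T = ∞, and define Q*_i(s, a₀) = ⨆ { G_i(s, a) : a(0) = a₀ } and V*_i(s) = ⨆_{a₀} Q*_i(s, a₀). Then for every i ∈ {1, …, N}, every s ∈ S_i, and every action a₀, Q*_i(s, a₀) = Q*(s, a₀). -/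

import Mathlib

/-- The controlled trajectory: `traj f s a 0 = s` and
`traj f s a (t+1) = f (traj f s a t) (a t)`. -/
def traj {S A : Type*} (f : S → A → S) (s : S) (a : ℕ → A) : ℕ → S
  | 0 => s
  | t + 1 => f (traj f s a t) (a t)

/-- The discounted return `G(s, a) = ∑ₜ γ^t R(s_{t+1}, a_t)`. -/
noncomputable def ret {S A : Type*} (f : S → A → S) (R : S → A → ℝ) (γ : ℝ)
    (s : S) (a : ℕ → A) : ℝ :=
  ∑' t : ℕ, γ ^ t * R (traj f s a (t + 1)) (a t)

/-- The optimal Q-function `Q*(s, a₀) = ⨆ {G(s, a) : a 0 = a₀}`. -/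
noncomputable def Qstar {S A : Type*} (f : S → A → S) (R : S → A → ℝ) (γ : ℝ)
    (s : S) (a₀ : A) : ℝ :=
  ⨆ a : {a : ℕ → A // a 0 = a₀}, ret f R γ s (a : ℕ → A)

open Classical

/-- The stage return `Gᵢ(s,a)` relative to a stage state-set `Sᵢ` and a
next-stage value function `V`: if the stage-transition time
`T = inf {t : s_t ∉ Sᵢ}` is finite,
`Gᵢ(s,a) = ∑_{t<T} γ^t R(s_{t+1}, a_t) + γ^T V(s_T)`; otherwise `Gᵢ(s,a) = G(s,a)`. -/
noncomputable def stageRet {S A : Type*} (f : S → A → S) (R : S → A → ℝ) (γ : ℝ)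
    (V : S → ℝ) (Si : Set S) (s : S) (a : ℕ → A) : ℝ :=
  if ∃ t, traj f s a t ∉ Si then
    (∑ t ∈ Finset.range (sInf {t | traj f s a t ∉ Si}),
        γ ^ t * R (traj f s a (t + 1)) (a t)) +
      γ ^ (sInf {t | traj f s a t ∉ Si}) * V (traj f s a (sInf {t | traj f s a t ∉ Si}))
  else ret f R γ s a

/-- The stage optimal Q-function `Qᵢ*(s, a₀) = ⨆ {Gᵢ(s, a) : a 0 = a₀}`. -/
noncomputable def stageQ {S A : Type*} (f : S → A → S) (R : S → A → ℝ) (γ : ℝ)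
    (V : S → ℝ) (Si : Set S) (s : S) (a₀ : A) : ℝ :=
  ⨆ a : {a : ℕ → A // a 0 = a₀}, stageRet f R γ V Si s (a : ℕ → A)

/-- The stage-wise optimal Q-functions, defined backwards: `Q*_N = Q*`
(and `Q*_i = Q*` for `i ≥ N`), and for `i < N`,
`Q*_i = stageQ` built from the stage set `Sᵢ` and the next-stage optimal value
function `V*_{i+1}(s) = ⨆_{a₀} Q*_{i+1}(s, a₀)`. -/
noncomputable def stageQi {S A : Type*} (f : S → A → S) (R : S → A → ℝ) (γ : ℝ)
    (N : ℕ) (Stage : ℕ → Set S) (i : ℕ) : S → A → ℝ :=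
  if h : i < N then
    stageQ f R γ (fun s => ⨆ a₀ : A, stageQi f R γ N Stage (i + 1) s a₀) (Stage i)
  else Qstar f R γ
termination_by N - i
decreasing_by omega

theorem traj_add {S A : Type*} (f : S → A → S) (s : S) (a : ℕ → A) (n t : ℕ) :
    traj f s a (n + t) = traj f (traj f s a n) (fun k => a (n + k)) t := by
  induction t with
  | zero => rfl
  | succ t ih =>
    change f (traj f s a (n + t)) (a (n + t)) = f _ _
    rw [ih]

theorem traj_congr {S A : Type*} (f : S → A → S) (s : S) {a b : ℕ → A} {n : ℕ}
    (h : ∀ t < n, a t = b t) : traj f s a n = traj f s b n := by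
  induction n with
  | zero => rfl
  | succ n ih =>
    change f _ _ = f _ _
    rw [ih fun t ht => h t (ht.trans n.lt_succ_self), h n n.lt_succ_self]

section Return

variable {S A : Type*} (f : S → A → S) {R : S → A → ℝ} {γ C : ℝ}

theorem norm_discounted_reward_le (hR : ∀ s a, |R s a| ≤ C) (hγ0 : 0 ≤ γ)
    (s : S) (a : ℕ → A) (t : ℕ) :
    ‖γ ^ t * R (traj f s a (t + 1)) (a t)‖ ≤ γ ^ t * C := by
  rw [norm_mul, Real.norm_of_nonneg (pow_nonneg hγ0 t)]
  exact mul_le_mul_of_nonneg_left (hR _ _) (pow_nonneg hγ0 t)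

theorem summable_discounted_reward (hR : ∀ s a, |R s a| ≤ C) (hγ0 : 0 ≤ γ) (hγ1 : γ < 1)
    (s : S) (a : ℕ → A) :
    Summable fun t => γ ^ t * R (traj f s a (t + 1)) (a t) :=
  Summable.of_norm_bounded ((summable_geometric_of_lt_one hγ0 hγ1).mul_right C)
    (norm_discounted_reward_le f hR hγ0 s a)

theorem ret_le (hR : ∀ s a, |R s a| ≤ C) (hγ0 : 0 ≤ γ) (hγ1 : γ < 1)
    (s : S) (a : ℕ → A) : ret f R γ s a ≤ ∑' t : ℕ, γ ^ t * C :=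
  (summable_discounted_reward f hR hγ0 hγ1 s a).tsum_le_tsum
    (fun t => (le_abs_self _).trans (norm_discounted_reward_le f hR hγ0 s a t))
    ((summable_geometric_of_lt_one hγ0 hγ1).mul_right C)

theorem bddAbove_range_ret_comp (hR : ∀ s a, |R s a| ≤ C) (hγ0 : 0 ≤ γ) (hγ1 : γ < 1)
    {ι : Sort*} (s : S) (g : ι → ℕ → A) :
    BddAbove (Set.range fun i => ret f R γ s (g i)) :=
  ⟨_, Set.forall_mem_range.2 fun i => ret_le f hR hγ0 hγ1 s (g i)⟩

/-- The return splits at time `n` into the reward collected before `n` and the discounted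
return of the remaining trajectory. -/
theorem ret_eq_sum_add (hR : ∀ s a, |R s a| ≤ C) (hγ0 : 0 ≤ γ) (hγ1 : γ < 1)
    (s : S) (a : ℕ → A) (n : ℕ) :
    ret f R γ s a = ∑ t ∈ Finset.range n, γ ^ t * R (traj f s a (t + 1)) (a t) +
      γ ^ n * ret f R γ (traj f s a n) fun k => a (n + k) := by
  rw [ret, ← (summable_discounted_reward f hR hγ0 hγ1 s a).sum_add_tsum_nat_add n, ret,
    ← tsum_mul_left]
  congr 1
  refine tsum_congr fun t => ?_
  rw [← traj_add, add_comm t n, pow_add, mul_assoc, add_assoc]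

theorem ret_le_Qstar (hR : ∀ s a, |R s a| ≤ C) (hγ0 : 0 ≤ γ) (hγ1 : γ < 1)
    (s : S) (a : ℕ → A) : ret f R γ s a ≤ Qstar f R γ s (a 0) :=
  le_ciSup (bddAbove_range_ret_comp f hR hγ0 hγ1 s
    (Subtype.val : {b : ℕ → A // b 0 = a 0} → ℕ → A)) ⟨a, rfl⟩

theorem iSup_Qstar (hR : ∀ s a, |R s a| ≤ C) (hγ0 : 0 ≤ γ) (hγ1 : γ < 1)
    [Nonempty A] (s : S) : ⨆ a₀, Qstar f R γ s a₀ = ⨆ a, ret f R γ s a := by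
  have hQ (a₀ : A) : Qstar f R γ s a₀ ≤ ⨆ a, ret f R γ s a :=
    have : Nonempty {a : ℕ → A // a 0 = a₀} := ⟨⟨fun _ => a₀, rfl⟩⟩
    ciSup_le fun a => le_ciSup (bddAbove_range_ret_comp f hR hγ0 hγ1 s id) a.1
  refine le_antisymm (ciSup_le hQ) (ciSup_le fun a => ?_)
  exact (ret_le_Qstar f hR hγ0 hγ1 s a).trans
    (le_ciSup (f := Qstar f R γ s) ⟨_, Set.forall_mem_range.2 hQ⟩ (a 0))

/-- Following `a` up to a positive time `n` and acting optimally afterwards does not beat the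
optimal Q-value of the first action. -/
theorem sum_add_pow_mul_iSup_ret_le_Qstar (hR : ∀ s a, |R s a| ≤ C) (hγ0 : 0 ≤ γ)
    (hγ1 : γ < 1) [Nonempty A] (s : S) (a : ℕ → A) {n : ℕ} (hn : 0 < n) :
    ∑ t ∈ Finset.range n, γ ^ t * R (traj f s a (t + 1)) (a t) +
      γ ^ n * ⨆ b, ret f R γ (traj f s a n) b ≤ Qstar f R γ s (a 0) := by
  rw [Real.mul_iSup_of_nonneg (pow_nonneg hγ0 n), ← le_sub_iff_add_le']
  refine ciSup_le fun b => ?_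
  rw [le_sub_iff_add_le']
  let c : ℕ → A := fun t => if t < n then a t else b (t - n)
  have hc (t : ℕ) (ht : t < n) : c t = a t := if_pos ht
  have hcb : (fun k => c (n + k)) = b := by
    funext k
    simp [c]
  have h := ret_le_Qstar f hR hγ0 hγ1 s c
  rw [ret_eq_sum_add f hR hγ0 hγ1 s c n, hcb, traj_congr f s hc, hc 0 hn] at h
  refine le_of_eq_of_le ?_ h
  congr 1
  refine Finset.sum_congr rfl fun t ht => ?_
  have ht := Finset.mem_range.1 ht
  rw [hc t ht, traj_congr f s fun k hk => hc k (hk.trans_le ht)]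

/-- Replacing the tail after leaving `Si` by the optimal value does not change the optimal
Q-function, as long as the value used is optimal at states entered from `Si`. -/
theorem stageQ_eq_Qstar (hR : ∀ s a, |R s a| ≤ C) (hγ0 : 0 ≤ γ) (hγ1 : γ < 1) [Nonempty A]
    {V : S → ℝ} {Si : Set S} (hV : ∀ s ∈ Si, ∀ a, V (f s a) = ⨆ b, ret f R γ (f s a) b)
    {s : S} (hs : s ∈ Si) (a₀ : A) : stageQ f R γ V Si s a₀ = Qstar f R γ s a₀ := by
  have hbounds (a : ℕ → A) : ret f R γ s a ≤ stageRet f R γ V Si s a ∧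
      stageRet f R γ V Si s a ≤ Qstar f R γ s (a 0) := by
    unfold stageRet
    split_ifs with hexit
    · have hT : traj f s a (sInf {t | traj f s a t ∉ Si}) ∉ Si := Nat.sInf_mem hexit
      have hlt (t : ℕ) (ht : t < sInf {t | traj f s a t ∉ Si}) : traj f s a t ∈ Si :=
        not_not.1 (Nat.notMem_of_lt_sInf ht)
      generalize sInf {t | traj f s a t ∉ Si} = T at hT hlt ⊢
      obtain _ | n := T
      · exact absurd hs hT
      have hVT : V (traj f s a (n + 1)) = ⨆ b, ret f R γ (traj f s a (n + 1)) b :=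
        hV _ (hlt n n.lt_succ_self) (a n)
      rw [hVT]
      refine ⟨?_, sum_add_pow_mul_iSup_ret_le_Qstar f hR hγ0 hγ1 s a n.succ_pos⟩
      rw [ret_eq_sum_add f hR hγ0 hγ1 s a (n + 1)]
      gcongr
      exact le_ciSup (bddAbove_range_ret_comp f hR hγ0 hγ1 _ id) _
    · exact ⟨le_rfl, ret_le_Qstar f hR hγ0 hγ1 s a⟩
  have : Nonempty {a : ℕ → A // a 0 = a₀} := ⟨⟨fun _ => a₀, rfl⟩⟩
  have hle (a : {a : ℕ → A // a 0 = a₀}) :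
      stageRet f R γ V Si s a ≤ Qstar f R γ s a₀ :=
    (hbounds a).2.trans_eq (congrArg _ a.2)
  exact le_antisymm (ciSup_le hle)
    (ciSup_mono ⟨_, Set.forall_mem_range.2 hle⟩ fun a => (hbounds a).1)

end Return

/-- (Proposition 1, part 1: stage-wise Q-value consistency.)
For an `N`-stage structure `S₁ ⊆ S₂ ⊆ ⋯ ⊆ S_N = S` with stage transitions only to
the next stage, the stage-wise optimal Q-functions agree with the optimal
Q-function of the whole problem: for every `i ∈ {1, …, N}`, `s ∈ Sᵢ`, and `a₀`,
`Q*ᵢ(s, a₀) = Q*(s, a₀)`. -/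
theorem stagewise_Q_consistency {S A : Type*} [Nonempty A]
    (f : S → A → S) (R : S → A → ℝ) (γ C : ℝ)
    (hC : 0 ≤ C) (hR : ∀ s a, |R s a| ≤ C)
    (hγ0 : 0 ≤ γ) (hγ1 : γ < 1)
    (N : ℕ) (Stage : ℕ → Set S)
    (hchain : ∀ i, 1 ≤ i → i < N → Stage i ⊆ Stage (i + 1))
    (htop : Stage N = Set.univ)
    (htrans : ∀ i, 1 ≤ i → i < N → ∀ s ∈ Stage i, ∀ a : A, f s a ∈ Stage (i + 1)) :
    ∀ i, 1 ≤ i → i ≤ N → ∀ s ∈ Stage i, ∀ a₀ : A,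
      stageQi f R γ N Stage i s a₀ = Qstar f R γ s a₀ := by
  intro i hi hiN
  induction hiN using Nat.decreasingInduction with
  | self =>
    intro s _ a₀
    rw [stageQi, dif_neg (lt_irrefl N)]
  | of_succ i hiN ih =>
    intro s hs a₀
    rw [stageQi, dif_pos hiN]
    refine stageQ_eq_Qstar f hR hγ0 hγ1 (fun s hs a => ?_) hs a₀
    rw [← iSup_Qstar f hR hγ0 hγ1]
    exact iSup_congr (ih (Nat.le_add_left 1 i) _ (htrans i hi hiN s hs a))
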